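/- arXiv:0805.3602 — 2 statements merged into one kernel-verified Lean document; each statement's English description precedes it below -/
import Mathlib

section
/- Fix positive reals α_0, α_1, and β^{(i)}_j, γ^{(i)}_j for 1 ≤ i ≤ k, 0 ≤ j ≤ t_i. Let U ∈ ℕ^n with N = U_1 + ⋯ + U_n. Then the marginal likelihood of U in the mixture model M^(2) with respect to the Dirichlet prior with parameters (α, β, γ), namely ∫_Θ L_U(σ,θ,ρ) f(σ,θ,ρ; α,β,γ) dσ dθ dρ, equals ( N! / (U_1!⋯U_n! · 𝔹(α,β,γ)) ) · Σ_{b ∈ Z_A^𝕃(U)} φ_A(b,U) · ( Γ(|b|/a + α_0) Γ(|c|/a + α_1) / Γ(N + α_0 + α_1) ) · ∏_{i=1}^k [ ( t_i! Γ(b^{(i)}_0 + β^{(i)}_0) ⋯ Γ(b^{(i)}_{t_i} + β^{(i)}_{t_i}) / Γ(|b^{(i)}| + |β^{(i)}|) ) · ( t_i! Γ(c^{(i)}_0 + γ^{(i)}_0) ⋯ Γ(c^{(i)}_{t_i} + γ^{(i)}_{t_i}) / Γ(|c^{(i)}| + |γ^{(i)}|) ) ], where c = A·U − b in each summand, |β^{(i)}|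 = β^{(i)}_0 + ⋯ + β^{(i)}_{t_i}, and Γ is the Gamma function. -/
open MeasureTheory

/-- Lebesgue probability measure on the standard probability simplex `Δ_t`. -/
noncomputable def simplexMeasure (t : ℕ) : Measure (Fin (t + 1) → ℝ) :=
  Measure.map (fun θ : Fin t → ℝ => Fin.cons (1 - ∑ i, θ i) θ)
    ((t.factorial : ENNReal) •
      volume.restrict {θ : Fin t → ℝ | (∀ i, 0 ≤ θ i) ∧ ∑ i, θ i ≤ 1})

/-- The state space `∏_{i=1}^k {0,…,t_i}^{s_i}` of the independence model. -/
abbrev SVState (k : ℕ) (s t : Fin k → ℕ) := ∀ i : Fin k, Fin (s i) → Fin (t i + 1)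

/-- The entry of the Segre–Veronese matrix `A` in row `(i,j)` and column `v`. -/
def SVcol (k : ℕ) (s t : Fin k → ℕ) (v : SVState k s t) (i : Fin k) (j : Fin (t i + 1)) : ℕ :=
  (Finset.univ.filter fun l : Fin (s i) => v i l = j).card

/-- `φ_A(b,U) = Σ_{0 ≤ x ≤ U, A·x = b} ∏_v C(U_v, x_v)`. -/
def phiSV (k : ℕ) (s t : Fin k → ℕ) (U : SVState k s t → ℕ)
    (b : ∀ i : Fin k, Fin (t i + 1) → ℤ) : ℕ :=
  ∑ x : ∀ v : SVState k s t, Fin (U v + 1),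
    if ∀ i j, ((∑ v, (x v : ℕ) * SVcol k s t v i j : ℕ) : ℤ) = b i j then
      ∏ v, (U v).choose (x v : ℕ)
    else 0

/-- `Z_A^𝕃(U)`: lattice points of `𝕃 = A·ℤ^n` in the zonotope `Z_A(U)`. -/
def ZAL (k : ℕ) (s t : Fin k → ℕ) (U : SVState k s t → ℕ) :
    Set (∀ i : Fin k, Fin (t i + 1) → ℤ) :=
  {b | (∃ z : SVState k s t → ℤ, ∀ i j, b i j = ∑ v, z v * (SVcol k s t v i j : ℤ)) ∧
       (∃ x : SVState k s t → ℝ, (∀ v, 0 ≤ x v ∧ x v ≤ (U v : ℝ)) ∧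
          ∀ i j, (b i j : ℝ) = ∑ v, x v * (SVcol k s t v i j : ℝ))}

/-- `c = A·U - b`. -/
def SVcompl (k : ℕ) (s t : Fin k → ℕ) (U : SVState k s t → ℕ)
    (b : ∀ i : Fin k, Fin (t i + 1) → ℤ) (i : Fin k) (j : Fin (t i + 1)) : ℤ :=
  ((∑ v, U v * SVcol k s t v i j : ℕ) : ℤ) - b i j

/-- The multinomial beta function `𝔹(δ) = m! Γ(δ_0)⋯Γ(δ_m)/Γ(δ_0+⋯+δ_m)`. -/
noncomputable def mBeta {m : ℕ} (δ : Fin (m + 1) → ℝ) : ℝ :=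
  (m.factorial : ℝ) * (∏ j, Real.Gamma (δ j)) / Real.Gamma (∑ j, δ j)

/-- The function `x ↦ x ^ (a - 1)`, extended by zero to negative arguments. -/
noncomputable def rpowIci (a : ℝ) : ℝ → ℝ :=
  (Set.Ici (0 : ℝ)).indicator fun x => x ^ (a - 1)

lemma rpowIci_nonneg (a x : ℝ) : 0 ≤ rpowIci a x :=
  Set.indicator_nonneg (fun _ hx => Real.rpow_nonneg hx _) x

lemma measurable_rpowIci (a : ℝ) : Measurable (rpowIci a) :=
  (measurable_id.pow_const _).indicator measurableSet_Ici

lemma rpowIci_mul (a : ℝ) {r : ℝ} (hr : 0 < r) (x : ℝ) :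
    rpowIci a (r * x) = r ^ (a - 1) * rpowIci a x := by
  by_cases hx : 0 ≤ x
  · simp [rpowIci, hx, mul_nonneg hr.le hx, Real.mul_rpow hr.le hx]
  · have : ¬ 0 ≤ r * x := by rw [mul_nonneg_iff_of_pos_left hr]; exact hx
    simp [rpowIci, hx, this]

lemma rpowIci_mul_exp_eq (a : ℝ) :
    (fun x => rpowIci a x * Real.exp (-x)) =
      (Set.Ici (0 : ℝ)).indicator fun x => Real.exp (-x) * x ^ (a - 1) := by
  ext x
  by_cases hx : 0 ≤ x <;> simp [rpowIci, hx, mul_comm]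

lemma integrable_rpowIci_mul_exp {a : ℝ} (ha : 0 < a) :
    Integrable fun x => rpowIci a x * Real.exp (-x) := by
  rw [rpowIci_mul_exp_eq, integrable_indicator_iff measurableSet_Ici,
    integrableOn_Ici_iff_integrableOn_Ioi]
  exact Real.GammaIntegral_convergent ha

lemma integral_rpowIci_mul_exp {a : ℝ} (ha : 0 < a) :
    ∫ x, rpowIci a x * Real.exp (-x) = Real.Gamma a := by
  rw [rpowIci_mul_exp_eq, integral_indicator measurableSet_Ici, integral_Ici_eq_integral_Ioi,
    Real.Gamma_eq_integral ha]

lemma lintegral_rpowIci_mul_exp {a : ℝ} (ha : 0 < a) :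
    ∫⁻ x, ENNReal.ofReal (rpowIci a x * Real.exp (-x)) = ENNReal.ofReal (Real.Gamma a) := by
  rw [← ofReal_integral_eq_lintegral_ofReal (integrable_rpowIci_mul_exp ha)
    (.of_forall fun x => mul_nonneg (rpowIci_nonneg a x) (Real.exp_pos _).le),
    integral_rpowIci_mul_exp ha]

lemma lintegral_prod_rpowIci_mul_exp {m : ℕ} {a : Fin m → ℝ} (ha : ∀ i, 0 < a i) :
    ∫⁻ y : Fin m → ℝ, ENNReal.ofReal (∏ i, rpowIci (a i) (y i) * Real.exp (-y i)) =
      ENNReal.ofReal (∏ i, Real.Gamma (a i)) := by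
  rw [← ofReal_integral_eq_lintegral_ofReal]
  · rw [integral_fintype_prod_volume_eq_prod fun i x => rpowIci (a i) x * Real.exp (-x)]
    simp_rw [integral_rpowIci_mul_exp (ha _)]
  · exact Integrable.fintype_prod (f := fun i x => rpowIci (a i) x * Real.exp (-x))
      fun i => integrable_rpowIci_mul_exp (ha i)
  · exact .of_forall fun y => Finset.prod_nonneg fun i _ =>
      mul_nonneg (rpowIci_nonneg _ _) (Real.exp_pos _).le

/-- The unnormalised Dirichlet density in affine coordinates on the simplex of size `r`. -/
noncomputable def dirichletKernel {m : ℕ} (δ : Fin (m + 1) → ℝ) (r : ℝ) (y : Fin m → ℝ) : ℝ :=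
  rpowIci (δ 0) (r - ∑ i, y i) * ∏ i, rpowIci (δ i.succ) (y i)

lemma measurable_dirichletKernel {m : ℕ} (δ : Fin (m + 1) → ℝ) :
    Measurable fun p : ℝ × (Fin m → ℝ) => dirichletKernel δ p.1 p.2 := by
  unfold dirichletKernel
  refine ((measurable_rpowIci _).comp (by fun_prop)).mul
    (Finset.measurable_prod _ fun i _ => (measurable_rpowIci _).comp (by fun_prop))

lemma lintegral_comp_smul_fin {m : ℕ} {r : ℝ} (hr : 0 < r) (f : (Fin m → ℝ) → ENNReal) :
    ∫⁻ y, f y = ENNReal.ofReal (r ^ m) * ∫⁻ y, f (r • y) := by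
  have h := Measure.map_addHaar_smul (volume : Measure (Fin m → ℝ)) hr.ne'
  have h2 := lintegral_map_equiv (μ := volume) f
    (Homeomorph.smulOfNeZero (α := Fin m → ℝ) r hr.ne').toMeasurableEquiv
  have hc : ⇑(Homeomorph.smulOfNeZero (α := Fin m → ℝ) r hr.ne').toMeasurableEquiv =
      (r • ·) := rfl
  rw [hc, h, lintegral_smul_measure, Module.finrank_fin_fun,
    abs_of_pos (inv_pos.2 (pow_pos hr m)), smul_eq_mul] at h2
  rw [← h2, ← mul_assoc, ← ENNReal.ofReal_mul (pow_nonneg hr.le m),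
    mul_inv_cancel₀ (pow_pos hr m).ne', ENNReal.ofReal_one, one_mul]

lemma lintegral_dirichletKernel_eq_mul {m : ℕ} (δ : Fin (m + 1) → ℝ) {r : ℝ} (hr : 0 < r) :
    ∫⁻ y, ENNReal.ofReal (dirichletKernel δ r y) =
      ENNReal.ofReal (r ^ ((∑ j, δ j) - 1)) * ∫⁻ y, ENNReal.ofReal (dirichletKernel δ 1 y) := by
  have hk : ∀ y, dirichletKernel δ r (r • y) =
      r ^ (∑ j, (δ j - 1)) * dirichletKernel δ 1 y := by
    intro y
    have : r - ∑ i, (r • y) i = r * (1 - ∑ i, y i) := by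
      simp [mul_sub, Finset.mul_sum]
    rw [dirichletKernel, this]
    simp only [dirichletKernel, Pi.smul_apply, smul_eq_mul, rpowIci_mul _ hr,
      Finset.prod_mul_distrib, Real.rpow_sum_of_pos hr, Fin.prod_univ_succ]
    ring
  rw [lintegral_comp_smul_fin hr]
  simp_rw [hk, ENNReal.ofReal_mul (Real.rpow_nonneg hr.le _)]
  rw [lintegral_const_mul' _ _ ENNReal.ofReal_ne_top, ← mul_assoc,
    ← ENNReal.ofReal_mul (by positivity), ← Real.rpow_natCast, ← Real.rpow_add hr]
  congr 3
  simp
  ring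

lemma dirichletKernel_of_neg {m : ℕ} (δ : Fin (m + 1) → ℝ) {r : ℝ} (hr : r < 0)
    (y : Fin m → ℝ) : dirichletKernel δ r y = 0 := by
  by_cases hy : ∀ i, 0 ≤ y i
  · have : ¬ (0 ≤ r - ∑ i, y i) := by
      have := Finset.sum_nonneg fun i (_ : i ∈ Finset.univ) => hy i
      linarith
    simp [dirichletKernel, rpowIci, this]
  · push Not at hy
    obtain ⟨i, hi⟩ := hy
    have : rpowIci (δ i.succ) (y i) = 0 := by simp [rpowIci, hi]
    rw [dirichletKernel, Finset.prod_eq_zero (Finset.mem_univ i) this, mul_zero]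

lemma lintegral_dirichletKernel {m : ℕ} {δ : Fin (m + 1) → ℝ} (hδ : ∀ j, 0 < δ j) :
    ∫⁻ y, ENNReal.ofReal (dirichletKernel δ 1 y) =
      ENNReal.ofReal ((∏ j, Real.Gamma (δ j)) / Real.Gamma (∑ j, δ j)) := by
  have hs : 0 < ∑ j, δ j := Finset.sum_pos (fun j _ => hδ j) Finset.univ_nonempty
  have hΓ := Real.Gamma_pos_of_pos hs
  have hmeas : Measurable fun p : ℝ × (Fin m → ℝ) =>
      ENNReal.ofReal (dirichletKernel δ p.1 p.2 * Real.exp (-p.1)) :=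
    ((measurable_dirichletKernel δ).mul (by fun_prop)).ennreal_ofReal
  have h1 : ∫⁻ r : ℝ, ∫⁻ y, ENNReal.ofReal (dirichletKernel δ r y * Real.exp (-r)) =
      ENNReal.ofReal (Real.Gamma (∑ j, δ j)) *
        ∫⁻ y, ENNReal.ofReal (dirichletKernel δ 1 y) := by
    rw [← lintegral_rpowIci_mul_exp hs, ← lintegral_mul_const _ (by
      exact ((measurable_rpowIci _).mul (by fun_prop)).ennreal_ofReal)]
    refine lintegral_congr_ae ?_
    filter_upwards [Measure.ae_ne volume (0 : ℝ)] with r hr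
    simp_rw [ENNReal.ofReal_mul' (Real.exp_pos (-r)).le]
    rw [lintegral_mul_const' _ _ ENNReal.ofReal_ne_top]
    rcases lt_or_gt_of_ne hr with hr | hr
    · simp [dirichletKernel_of_neg δ hr, rpowIci, hr]
    · rw [lintegral_dirichletKernel_eq_mul δ hr]
      simp only [rpowIci, Set.mem_Ici, hr.le, Set.indicator_of_mem]
      ring
  have h2 : ∫⁻ r : ℝ, ∫⁻ y, ENNReal.ofReal (dirichletKernel δ r y * Real.exp (-r)) =
      ENNReal.ofReal (∏ j, Real.Gamma (δ j)) := by
    rw [lintegral_lintegral_swap hmeas.aemeasurable]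
    have : ∀ y : Fin m → ℝ,
        ∫⁻ r, ENNReal.ofReal (dirichletKernel δ r y * Real.exp (-r)) =
          ENNReal.ofReal (Real.Gamma (δ 0)) *
            ENNReal.ofReal (∏ i, rpowIci (δ i.succ) (y i) * Real.exp (-y i)) := by
      intro y
      rw [← lintegral_rpowIci_mul_exp (hδ 0),
        ← lintegral_sub_right_eq_self
          (fun x => ENNReal.ofReal (rpowIci (δ 0) x * Real.exp (-x))) (∑ i, y i),
        ← lintegral_mul_const' _ _ ENNReal.ofReal_ne_top]
      refine lintegral_congr fun r => ?_
      rw [← ENNReal.ofReal_mul (mul_nonneg (rpowIci_nonneg _ _) (Real.exp_pos _).le)]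
      congr 1
      rw [dirichletKernel, Finset.prod_mul_distrib, ← Real.exp_sum, neg_sub, Real.exp_sub,
        Finset.sum_neg_distrib, Real.exp_neg, Real.exp_neg]
      field_simp
    simp_rw [this]
    rw [lintegral_const_mul' _ _ ENNReal.ofReal_ne_top,
      lintegral_prod_rpowIci_mul_exp fun i => hδ i.succ,
      ← ENNReal.ofReal_mul (Real.Gamma_pos_of_pos (hδ 0)).le, Fin.prod_univ_succ]
  rw [ENNReal.ofReal_div_of_pos hΓ, ENNReal.eq_div_iff (by simpa using hΓ) ENNReal.ofReal_ne_top,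
    ← h1, h2]

lemma measurable_simplexParam (m : ℕ) :
    Measurable fun θ : Fin m → ℝ => (Fin.cons (1 - ∑ i, θ i) θ : Fin (m + 1) → ℝ) := by
  refine measurable_pi_lambda _ fun j => ?_
  refine Fin.cases ?_ (fun i => ?_) j
  · simp only [Fin.cons_zero]; fun_prop
  · simp only [Fin.cons_succ]; fun_prop

lemma lintegral_simplexMeasure_rpow {m : ℕ} {δ : Fin (m + 1) → ℝ} (hδ : ∀ j, 0 < δ j) :
    ∫⁻ p, ENNReal.ofReal (∏ j, p j ^ (δ j - 1)) ∂simplexMeasure m =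
      ENNReal.ofReal (mBeta δ) := by
  have hS : MeasurableSet {θ : Fin m → ℝ | (∀ i, 0 ≤ θ i) ∧ ∑ i, θ i ≤ 1} := by measurability
  rw [simplexMeasure, lintegral_map (by fun_prop) (measurable_simplexParam m),
    lintegral_smul_measure, ← lintegral_indicator hS, mBeta, mul_div_assoc,
    ENNReal.ofReal_mul (by positivity), ENNReal.ofReal_natCast, smul_eq_mul,
    ← lintegral_dirichletKernel hδ]
  congr 1
  refine lintegral_congr fun y => ?_
  by_cases hy : y ∈ {θ : Fin m → ℝ | (∀ i, 0 ≤ θ i) ∧ ∑ i, θ i ≤ 1}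
  · have h1 := hy.1
    have h2 := hy.2
    simp [dirichletKernel, rpowIci, Fin.prod_univ_succ, h1, h2]
  · rw [Set.indicator_of_notMem hy]
    symm
    by_cases h1 : ∀ i, 0 ≤ y i
    · have h2 : ¬ ∑ i, y i ≤ 1 := fun h => hy ⟨h1, h⟩
      simp [dirichletKernel, rpowIci, h2]
    · push Not at h1
      obtain ⟨i, hi⟩ := h1
      have : rpowIci (δ i.succ) (y i) = 0 := by simp [rpowIci, hi]
      rw [dirichletKernel, Finset.prod_eq_zero (Finset.mem_univ i) this, mul_zero,
        ENNReal.ofReal_zero]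

lemma ae_nonneg_simplexMeasure (m : ℕ) : ∀ᵐ p ∂simplexMeasure m, ∀ j, 0 ≤ p j := by
  have hS : MeasurableSet {θ : Fin m → ℝ | (∀ i, 0 ≤ θ i) ∧ ∑ i, θ i ≤ 1} := by measurability
  rw [simplexMeasure, ae_map_iff (measurable_simplexParam m).aemeasurable (by measurability)]
  refine Measure.ae_smul_measure ?_ _
  filter_upwards [ae_restrict_mem hS] with y hy j
  refine Fin.cases ?_ (fun i => ?_) j
  · simpa using hy.2
  · simpa using hy.1 i

instance isProbabilityMeasure_simplexMeasure (m : ℕ) :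
    IsProbabilityMeasure (simplexMeasure m) := by
  constructor
  have h := lintegral_simplexMeasure_rpow (m := m) (δ := fun _ => 1) fun _ => one_pos
  have hf : (m.factorial : ℝ) ≠ 0 := by positivity
  simpa [mBeta, Real.Gamma_nat_eq_factorial, hf] using h

lemma mBeta_pos {m : ℕ} {δ : Fin (m + 1) → ℝ} (hδ : ∀ j, 0 < δ j) : 0 < mBeta δ := by
  have hs : 0 < ∑ j, δ j := Finset.sum_pos (fun j _ => hδ j) Finset.univ_nonempty
  exact div_pos (mul_pos (by positivity)
    (Finset.prod_pos fun j _ => Real.Gamma_pos_of_pos (hδ j))) (Real.Gamma_pos_of_pos hs)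

lemma measurable_prod_rpow {m : ℕ} (δ : Fin (m + 1) → ℝ) :
    Measurable fun p : Fin (m + 1) → ℝ => ∏ j, p j ^ (δ j - 1) := by
  fun_prop

lemma ae_nonneg_prod_rpow {m : ℕ} (δ : Fin (m + 1) → ℝ) :
    0 ≤ᵐ[simplexMeasure m] fun p => ∏ j, p j ^ (δ j - 1) := by
  filter_upwards [ae_nonneg_simplexMeasure m] with p hp
  exact Finset.prod_nonneg fun j _ => Real.rpow_nonneg (hp j) _

lemma integrable_simplexMeasure_rpow {m : ℕ} {δ : Fin (m + 1) → ℝ} (hδ : ∀ j, 0 < δ j) :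
    Integrable (fun p => ∏ j, p j ^ (δ j - 1)) (simplexMeasure m) := by
  refine ⟨(measurable_prod_rpow δ).aestronglyMeasurable, ?_⟩
  rw [hasFiniteIntegral_iff_ofReal (ae_nonneg_prod_rpow δ), lintegral_simplexMeasure_rpow hδ]
  exact ENNReal.ofReal_lt_top

lemma integral_simplexMeasure_rpow {m : ℕ} {δ : Fin (m + 1) → ℝ} (hδ : ∀ j, 0 < δ j) :
    ∫ p, ∏ j, p j ^ (δ j - 1) ∂simplexMeasure m = mBeta δ := by
  rw [integral_eq_lintegral_of_nonneg_ae (ae_nonneg_prod_rpow δ)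
    (measurable_prod_rpow δ).aestronglyMeasurable, lintegral_simplexMeasure_rpow hδ,
    ENNReal.toReal_ofReal (mBeta_pos hδ).le]

/-- The monomial with exponent `n` times the Dirichlet density with parameters `δ`. -/
noncomputable def dirichletMonomial {m : ℕ} (δ : Fin (m + 1) → ℝ) (n : Fin (m + 1) → ℕ)
    (p : Fin (m + 1) → ℝ) : ℝ :=
  (∏ j, p j ^ n j) * ((∏ j, p j ^ (δ j - 1)) / mBeta δ)

lemma dirichletMonomial_ae_eq {m : ℕ} {δ : Fin (m + 1) → ℝ} (hδ : ∀ j, 0 < δ j)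
    (n : Fin (m + 1) → ℕ) :
    dirichletMonomial δ n =ᵐ[simplexMeasure m]
      fun p => (∏ j, p j ^ (((n j : ℝ) + δ j) - 1)) / mBeta δ := by
  filter_upwards [ae_nonneg_simplexMeasure m] with p hp
  rw [dirichletMonomial, ← mul_div_assoc, ← Finset.prod_mul_distrib]
  congr 1
  refine Finset.prod_congr rfl fun j _ => ?_
  rcases Nat.eq_zero_or_pos (n j) with h | h
  · simp [h]
  · have h1 : (1 : ℝ) ≤ n j := by exact_mod_cast h
    rw [← Real.rpow_natCast, ← Real.rpow_add' (hp j) (by linarith [hδ j]), add_sub_assoc]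

lemma integrable_dirichletMonomial {m : ℕ} {δ : Fin (m + 1) → ℝ} (hδ : ∀ j, 0 < δ j)
    (n : Fin (m + 1) → ℕ) : Integrable (dirichletMonomial δ n) (simplexMeasure m) :=
  ((integrable_simplexMeasure_rpow fun j =>
    add_pos_of_nonneg_of_pos (n j).cast_nonneg (hδ j)).div_const _).congr
    (dirichletMonomial_ae_eq hδ n).symm

lemma integral_dirichletMonomial {m : ℕ} {δ : Fin (m + 1) → ℝ} (hδ : ∀ j, 0 < δ j)
    (n : Fin (m + 1) → ℕ) :
    ∫ p, dirichletMonomial δ n p ∂simplexMeasure m =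
      mBeta (fun j => (n j : ℝ) + δ j) / mBeta δ := by
  rw [integral_congr_ae (dirichletMonomial_ae_eq hδ n), integral_div,
    integral_simplexMeasure_rpow fun j => add_pos_of_nonneg_of_pos (n j).cast_nonneg (hδ j)]

lemma mBeta_two (δ : Fin 2 → ℝ) :
    mBeta (m := 1) δ = Real.Gamma (δ 0) * Real.Gamma (δ 1) / Real.Gamma (δ 0 + δ 1) := by
  rw [mBeta, Fin.prod_univ_two (fun j => Real.Gamma (δ j)), Fin.sum_univ_two δ]
  simp

lemma dirichletMonomial_two (δ : Fin 2 → ℝ) (n : Fin 2 → ℕ) (p : Fin 2 → ℝ) :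
    dirichletMonomial (m := 1) δ n p =
      p 0 ^ n 0 * p 1 ^ n 1 * ((∏ j, p j ^ (δ j - 1)) / mBeta δ) := by
  rw [dirichletMonomial, Fin.prod_univ_two (fun j => p j ^ n j)]

/-- `A·x` for the Segre–Veronese matrix `A`. -/
def SVmulVec (k : ℕ) (s t : Fin k → ℕ) (x : SVState k s t → ℕ) (i : Fin k)
    (j : Fin (t i + 1)) : ℕ :=
  ∑ v, x v * SVcol k s t v i j

lemma sum_SVcol {k : ℕ} {s t : Fin k → ℕ} (v : SVState k s t) (i : Fin k) :
    ∑ j, SVcol k s t v i j = s i := by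
  have h := Finset.card_eq_sum_card_fiberwise (s := (Finset.univ : Finset (Fin (s i))))
    (t := Finset.univ) (f := v i) fun _ _ => Finset.mem_coe.2 (Finset.mem_univ _)
  rw [Finset.card_univ, Fintype.card_fin] at h
  exact h.symm

lemma sum_SVmulVec {k : ℕ} {s t : Fin k → ℕ} (x : SVState k s t → ℕ) :
    ∑ i, ∑ j, SVmulVec k s t x i j = (∑ v, x v) * ∑ i, s i := by
  have : ∀ i, ∑ j, SVmulVec k s t x i j = (∑ v, x v) * s i := fun i => by
    simp only [SVmulVec]
    rw [Finset.sum_comm, Finset.sum_mul]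
    simp_rw [← Finset.mul_sum, sum_SVcol]
  simp_rw [this, Finset.mul_sum]

lemma prod_monomial_pow {k : ℕ} {s t : Fin k → ℕ} (θ : ∀ i : Fin k, Fin (t i + 1) → ℝ)
    (x : SVState k s t → ℕ) :
    ∏ v, (∏ i, ∏ j, θ i j ^ SVcol k s t v i j) ^ x v =
      ∏ i, ∏ j, θ i j ^ SVmulVec k s t x i j := by
  simp only [SVmulVec, ← Finset.prod_pow_eq_pow_sum, ← Finset.prod_pow, ← pow_mul]
  rw [Finset.prod_comm]
  refine Finset.prod_congr rfl fun i _ => ?_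
  rw [Finset.prod_comm]
  simp_rw [mul_comm]

lemma prod_mixture_pow {V R : Type*} [Fintype V] [DecidableEq V] [CommSemiring R] (U : V → ℕ)
    (p q : R) (f g : V → R) :
    ∏ v, (p * f v + q * g v) ^ U v =
      ∑ x : ∀ v, Fin (U v + 1), ((∏ v, (U v).choose (x v : ℕ) : ℕ) : R) *
        (p ^ (∑ v, (x v : ℕ)) * q ^ (∑ v, (U v - x v)) *
          ((∏ v, f v ^ (x v : ℕ)) * ∏ v, g v ^ (U v - x v))) := by
  have h : ∀ v, (p * f v + q * g v) ^ U v = ∑ x : Fin (U v + 1),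
      (p * f v) ^ (x : ℕ) * (q * g v) ^ (U v - x) * ((U v).choose x : R) := fun v => by
    rw [add_pow, Finset.sum_range]
  simp_rw [h]
  rw [Finset.prod_univ_sum, Fintype.piFinset_univ]
  refine Finset.sum_congr rfl fun x _ => ?_
  simp only [Finset.prod_mul_distrib, mul_pow, Finset.prod_pow_eq_pow_sum, Nat.cast_prod]
  ring

/-- The integral over `Θ` of a monomial against the product of Dirichlet densities. -/
lemma integral_prod_dirichletMonomial {k : ℕ} {t : Fin k → ℕ} {α : Fin 2 → ℝ}
    (hα : ∀ j, 0 < α j) {β γ : ∀ i : Fin k, Fin (t i + 1) → ℝ}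
    (hβ : ∀ i j, 0 < β i j) (hγ : ∀ i j, 0 < γ i j)
    (e : Fin 2 → ℕ) (b c : ∀ i : Fin k, Fin (t i + 1) → ℕ) :
    Integrable (fun p : (Fin 2 → ℝ) ×
        ((∀ i : Fin k, Fin (t i + 1) → ℝ) × (∀ i : Fin k, Fin (t i + 1) → ℝ)) =>
        dirichletMonomial α e p.1 * ((∏ i, dirichletMonomial (β i) (b i) (p.2.1 i)) *
          ∏ i, dirichletMonomial (γ i) (c i) (p.2.2 i)))
        ((simplexMeasure 1).prod
            ((Measure.pi fun i => simplexMeasure (t i)).prod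
              (Measure.pi fun i => simplexMeasure (t i)))) ∧
    ∫ p : (Fin 2 → ℝ) ×
        ((∀ i : Fin k, Fin (t i + 1) → ℝ) × (∀ i : Fin k, Fin (t i + 1) → ℝ)),
        dirichletMonomial α e p.1 * ((∏ i, dirichletMonomial (β i) (b i) (p.2.1 i)) *
          ∏ i, dirichletMonomial (γ i) (c i) (p.2.2 i))
        ∂((simplexMeasure 1).prod
            ((Measure.pi fun i => simplexMeasure (t i)).prod
              (Measure.pi fun i => simplexMeasure (t i)))) =
      mBeta (fun j => (e j : ℝ) + α j) / mBeta α *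
        ((∏ i, mBeta (fun j => (b i j : ℝ) + β i j) / mBeta (β i)) *
          ∏ i, mBeta (fun j => (c i j : ℝ) + γ i j) / mBeta (γ i)) := by
  have hb := Integrable.fintype_prod_dep (μ := fun i => simplexMeasure (t i))
    (f := fun i => dirichletMonomial (β i) (b i)) fun i => integrable_dirichletMonomial (hβ i) (b i)
  have hc := Integrable.fintype_prod_dep (μ := fun i => simplexMeasure (t i))
    (f := fun i => dirichletMonomial (γ i) (c i)) fun i => integrable_dirichletMonomial (hγ i) (c i)
  refine ⟨(integrable_dirichletMonomial hα e).mul_prod (hb.mul_prod hc), ?_⟩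
  rw [integral_prod_mul (dirichletMonomial α e)
      fun q : (∀ i : Fin k, Fin (t i + 1) → ℝ) × (∀ i : Fin k, Fin (t i + 1) → ℝ) =>
        (∏ i, dirichletMonomial (β i) (b i) (q.1 i)) *
          ∏ i, dirichletMonomial (γ i) (c i) (q.2 i),
    integral_prod_mul
      (fun θ : ∀ i : Fin k, Fin (t i + 1) → ℝ => ∏ i, dirichletMonomial (β i) (b i) (θ i))
      fun ρ : ∀ i : Fin k, Fin (t i + 1) → ℝ => ∏ i, dirichletMonomial (γ i) (c i) (ρ i),
    integral_fintype_prod_eq_prod fun i => dirichletMonomial (β i) (b i),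
    integral_fintype_prod_eq_prod fun i => dirichletMonomial (γ i) (c i),
    integral_dirichletMonomial hα]
  simp_rw [integral_dirichletMonomial (hβ _), integral_dirichletMonomial (hγ _)]

/-- A sum over `Z_A^𝕃(U)` weighted by `φ_A` is a sum over all `0 ≤ x ≤ U`. -/
lemma finsum_ZAL_phiSV_mul {k : ℕ} {s t : Fin k → ℕ} (U : SVState k s t → ℕ)
    (G : (∀ i : Fin k, Fin (t i + 1) → ℤ) → ℝ) :
    ∑ᶠ b ∈ ZAL k s t U, (phiSV k s t U b : ℝ) * G b =
      ∑ x : ∀ v : SVState k s t, Fin (U v + 1), ((∏ v, (U v).choose (x v : ℕ) : ℕ) : ℝ) *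
        G fun i j => (SVmulVec k s t (fun v => x v) i j : ℤ) := by
  classical
  set A : (∀ v : SVState k s t, Fin (U v + 1)) → ∀ i : Fin k, Fin (t i + 1) → ℤ :=
    fun x i j => (SVmulVec k s t (fun v => x v) i j : ℤ) with hA
  have hphi : ∀ b, (phiSV k s t U b : ℝ) =
      ∑ x, if A x = b then ((∏ v, (U v).choose (x v : ℕ) : ℕ) : ℝ) else 0 := fun b => by
    rw [phiSV, Nat.cast_sum]
    refine Finset.sum_congr rfl fun x _ => ?_
    have : A x = b ↔ ∀ i j, ((∑ v, (x v : ℕ) * SVcol k s t v i j : ℕ) : ℤ) = b i j := by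
      simp only [funext_iff]; rfl
    simp only [this]
    split_ifs <;> simp
  rw [finsum_mem_eq_sum_of_subset (t := Finset.univ.image A)]
  · simp_rw [hphi, Finset.sum_mul]
    rw [Finset.sum_comm]
    refine Finset.sum_congr rfl fun x _ => ?_
    simp_rw [ite_mul, zero_mul]
    rw [Finset.sum_ite_eq, if_pos (Finset.mem_image_of_mem A (Finset.mem_univ x))]
  · rintro b ⟨-, hb⟩
    have hb : (phiSV k s t U b : ℝ) ≠ 0 := left_ne_zero_of_mul hb
    rw [hphi] at hb
    obtain ⟨x, -, hx⟩ := Finset.exists_ne_zero_of_sum_ne_zero hb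
    simp only [Finset.coe_image, Finset.coe_univ, Set.image_univ, Set.mem_range]
    exact ⟨x, by by_contra h; simp [h] at hx⟩
  · intro b hb
    simp only [Finset.coe_image, Finset.coe_univ, Set.image_univ, Set.mem_range] at hb
    obtain ⟨x, rfl⟩ := hb
    refine ⟨⟨fun v => (x v : ℕ), fun i j => by simp [hA, SVmulVec]⟩,
      fun v => (x v : ℕ), fun v => ⟨by positivity, ?_⟩, fun i j => by simp [hA, SVmulVec]⟩
    exact Nat.cast_le.2 (Nat.lt_succ_iff.1 (x v).2)

lemma SVcompl_SVmulVec {k : ℕ} {s t : Fin k → ℕ} {U x : SVState k s t → ℕ}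
    (hx : ∀ v, x v ≤ U v) (i : Fin k) (j : Fin (t i + 1)) :
    SVcompl k s t U (fun i j => (SVmulVec k s t x i j : ℤ)) i j =
      (SVmulVec k s t (fun v => U v - x v) i j : ℤ) := by
  rw [SVcompl, sub_eq_iff_eq_add, SVmulVec, SVmulVec, ← Nat.cast_add, ← Finset.sum_add_distrib]
  congr 1
  exact Finset.sum_congr rfl fun v _ => by rw [← add_mul, Nat.sub_add_cancel (hx v)]

lemma sum_toNat_div {k : ℕ} {s t : Fin k → ℕ} (hs : 0 < ∑ i, s i) (x : SVState k s t → ℕ) :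
    (∑ i, ∑ j, (SVmulVec k s t x i j : ℤ)).toNat / (∑ i, s i) = ∑ v, x v := by
  have : (∑ i, ∑ j, (SVmulVec k s t x i j : ℤ)) =
      ((∑ i, ∑ j, SVmulVec k s t x i j : ℕ) : ℤ) := by push_cast; rfl
  rw [this, Int.toNat_natCast, sum_SVmulVec, Nat.mul_div_cancel _ hs]

/-- Corollary 3 (Dirichlet priors): the marginal likelihood
`∫_Θ L_U(σ,θ,ρ) f(σ,θ,ρ;α,β,γ) dσ dθ dρ` of `U` in the mixture model `M^(2)` with
respect to the Dirichlet prior with parameters `(α,β,γ)` equals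
`N!/(U_1!⋯U_n!·𝔹(α,β,γ))` times the sum over `b ∈ Z_A^𝕃(U)`, `c = A·U-b`, of
`φ_A(b,U) · Γ(|b|/a+α_0)Γ(|c|/a+α_1)/Γ(N+α_0+α_1) ·
 ∏_i [t_i!Γ(b^{(i)}_0+β^{(i)}_0)⋯/Γ(|b^{(i)}|+|β^{(i)}|)]·[t_i!Γ(c^{(i)}_0+γ^{(i)}_0)⋯/Γ(|c^{(i)}|+|γ^{(i)}|)]`. -/
theorem marginal_likelihood_dirichlet (k : ℕ) (s t : Fin k → ℕ)
    (hk : 0 < k) (hs : ∀ i, 0 < s i) (ht : ∀ i, 0 < t i)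
    (α : Fin 2 → ℝ) (hα : ∀ j, 0 < α j)
    (β γ : ∀ i : Fin k, Fin (t i + 1) → ℝ)
    (hβ : ∀ i j, 0 < β i j) (hγ : ∀ i j, 0 < γ i j)
    (U : SVState k s t → ℕ) (N : ℕ) (hN : N = ∑ v, U v) :
    (∫ p : (Fin 2 → ℝ) ×
        ((∀ i : Fin k, Fin (t i + 1) → ℝ) × (∀ i : Fin k, Fin (t i + 1) → ℝ)),
        (((N.factorial : ℝ) / ∏ v, ((U v).factorial : ℝ)) *
            ∏ v, (p.1 0 * (∏ i, ∏ j, p.2.1 i j ^ SVcol k s t v i j) +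
                  p.1 1 * (∏ i, ∏ j, p.2.2 i j ^ SVcol k s t v i j)) ^ U v) *
          (((∏ j, p.1 j ^ (α j - 1)) / mBeta α) *
            (∏ i, (∏ j, p.2.1 i j ^ (β i j - 1)) / mBeta (β i)) *
            (∏ i, (∏ j, p.2.2 i j ^ (γ i j - 1)) / mBeta (γ i)))
        ∂((simplexMeasure 1).prod
            ((Measure.pi fun i => simplexMeasure (t i)).prod
              (Measure.pi fun i => simplexMeasure (t i)))))
      = ((N.factorial : ℝ) /
            ((∏ v, ((U v).factorial : ℝ)) *
              (mBeta α * (∏ i, mBeta (β i)) * ∏ i, mBeta (γ i)))) *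
          ∑ᶠ b ∈ ZAL k s t U,
            (phiSV k s t U b : ℝ)
              * (Real.Gamma ((((∑ i, ∑ j, b i j).toNat / (∑ i, s i) : ℕ) : ℝ) + α 0) *
                 Real.Gamma ((((∑ i, ∑ j, SVcompl k s t U b i j).toNat / (∑ i, s i) : ℕ) : ℝ)
                    + α 1) /
                 Real.Gamma ((N : ℝ) + α 0 + α 1))
              * ∏ i,
                  ((((t i).factorial : ℝ) *
                      ∏ j, Real.Gamma ((b i j : ℝ) + β i j)) /
                    Real.Gamma (((∑ j, b i j : ℤ) : ℝ) + ∑ j, β i j) *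
                   ((((t i).factorial : ℝ) *
                      ∏ j, Real.Gamma ((SVcompl k s t U b i j : ℝ) + γ i j)) /
                    Real.Gamma (((∑ j, SVcompl k s t U b i j : ℤ) : ℝ) + ∑ j, γ i j))) := by
  have hs' : 0 < ∑ i, s i :=
    Finset.sum_pos (fun i _ => hs i) ⟨⟨0, hk⟩, Finset.mem_univ _⟩
  simp_rw [mul_assoc (phiSV k s t U _ : ℝ)]
  rw [finsum_ZAL_phiSV_mul]
  set K : ℝ := (N.factorial : ℝ) / ∏ v, ((U v).factorial : ℝ) with hK
  have hint : ∀ p : (Fin 2 → ℝ) ×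
        ((∀ i : Fin k, Fin (t i + 1) → ℝ) × (∀ i : Fin k, Fin (t i + 1) → ℝ)),
      (K * ∏ v, (p.1 0 * (∏ i, ∏ j, p.2.1 i j ^ SVcol k s t v i j) +
                  p.1 1 * (∏ i, ∏ j, p.2.2 i j ^ SVcol k s t v i j)) ^ U v) *
          (((∏ j, p.1 j ^ (α j - 1)) / mBeta α) *
            (∏ i, (∏ j, p.2.1 i j ^ (β i j - 1)) / mBeta (β i)) *
            (∏ i, (∏ j, p.2.2 i j ^ (γ i j - 1)) / mBeta (γ i))) =
      ∑ x : ∀ v : SVState k s t, Fin (U v + 1),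
        K * ((∏ v, (U v).choose (x v : ℕ) : ℕ) : ℝ) *
        (dirichletMonomial α ![∑ v, (x v : ℕ), ∑ v, (U v - x v)] p.1 *
          ((∏ i, dirichletMonomial (β i) (SVmulVec k s t (fun v => x v) i) (p.2.1 i)) *
            ∏ i, dirichletMonomial (γ i) (SVmulVec k s t (fun v => U v - x v) i) (p.2.2 i))) := by
    intro p
    rw [prod_mixture_pow, Finset.mul_sum, Finset.sum_mul]
    refine Finset.sum_congr rfl fun x _ => ?_
    rw [prod_monomial_pow p.2.1 fun v => (x v : ℕ), prod_monomial_pow p.2.2 fun v => U v - x v]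
    rw [dirichletMonomial_two]
    simp only [dirichletMonomial, Finset.prod_mul_distrib, Matrix.cons_val_zero,
      Matrix.cons_val_one]
    ring
  simp_rw [hint]
  rw [integral_finsetSum _ fun x _ =>
    (integral_prod_dirichletMonomial hα hβ hγ _ _ _).1.const_mul _, Finset.mul_sum]
  refine Finset.sum_congr rfl fun x _ => ?_
  have hx : ∀ v, (x v : ℕ) ≤ U v := fun v => Nat.lt_succ_iff.1 (x v).2
  rw [integral_const_mul, (integral_prod_dirichletMonomial hα hβ hγ _ _ _).2]
  simp_rw [SVcompl_SVmulVec hx]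
  rw [sum_toNat_div hs', sum_toNat_div hs']
  have hNx : (N : ℝ) = ((∑ v, (x v : ℕ) : ℕ) : ℝ) + ((∑ v, (U v - x v) : ℕ) : ℝ) := by
    rw [hN, ← Nat.cast_add, ← Finset.sum_add_distrib]
    congr 1
    exact Finset.sum_congr rfl fun v _ => (Nat.add_sub_of_le (hx v)).symm
  have hα' : mBeta (fun j => ((![∑ v, (x v : ℕ), ∑ v, (U v - x v)] j : ℕ) : ℝ) + α j) =
      Real.Gamma (((∑ v, (x v : ℕ) : ℕ) : ℝ) + α 0) *
        Real.Gamma (((∑ v, (U v - x v) : ℕ) : ℝ) + α 1) / Real.Gamma ((N : ℝ) + α 0 + α 1) := by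
    rw [mBeta_two]
    simp only [Matrix.cons_val_zero, Matrix.cons_val_one]
    rw [hNx, add_add_add_comm, ← add_assoc]
  have hδ' : ∀ (i : Fin k) (b : Fin (t i + 1) → ℕ) (δ : Fin (t i + 1) → ℝ),
      ((t i).factorial : ℝ) * (∏ j, Real.Gamma (((b j : ℤ) : ℝ) + δ j)) /
        Real.Gamma (((∑ j, (b j : ℤ) : ℤ) : ℝ) + ∑ j, δ j) =
      mBeta (fun j => (b j : ℝ) + δ j) := fun i b δ => by
    simp only [mBeta, Finset.sum_add_distrib, Int.cast_sum, Int.cast_natCast]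
  simp_rw [hδ']
  rw [hα', Finset.prod_mul_distrib, Finset.prod_div_distrib, Finset.prod_div_distrib, hK]
  ring
end

section
/- Let U be the 4×4 integer matrix with all diagonal entries equal to 4 and all off-diagonal entries equal to 2, with rows and columns indexed by {1,2,3,4}. Then ∫_Θ ∏_{i=1}^4 ∏_{j=1}^4 ( π λ^{(1)}_i λ^{(2)}_j + τ ρ^{(1)}_i ρ^{(2)}_j )^{U_{ij}} dπ dτ dλ dρ = (571 · 773426813 · 17682039596993 · 625015426432626533) / (2^31 · 3^20 · 5^12 · 7^11 · 11^8 · 13^7 · 17^5 · 19^5 · 23^5 · 29^3 · 31^3 · 37^3 · 41^3 · 43^2). -/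
open MeasureTheory

namespace Finset

theorem sum_mul_pow_div_pow_mod {B : ℕ} (a : ℕ → ℕ) (ha : ∀ i, a i < B) (M m : ℕ) (hm : m < M) :
    (∑ i ∈ range M, a i * B ^ i) / B ^ m % B = a m := by
  have hB : 0 < B := (Nat.zero_le _).trans_lt (ha 0)
  induction m generalizing a M with
  | zero =>
    obtain ⟨M, rfl⟩ : ∃ k, M = k + 1 := ⟨M - 1, by omega⟩
    simp only [sum_range_succ', pow_succ, ← mul_assoc, ← sum_mul]
    simp [Nat.mod_eq_of_lt (ha 0)]
  | succ m ih =>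
    obtain ⟨M, rfl⟩ : ∃ k, M = k + 1 := ⟨M - 1, by omega⟩
    rw [← ih (fun i => a (i + 1)) (fun i => ha _) M (by omega), pow_succ' B m,
      ← Nat.div_div_eq_div_mul]
    simp only [sum_range_succ', pow_succ, ← mul_assoc, ← sum_mul]
    rw [pow_zero, mul_one, add_comm, Nat.add_mul_div_right _ _ hB, Nat.div_eq_of_lt (ha 0), zero_add]

/-- Kronecker substitution: if the coefficients of `∑ i ∈ S, c i * X ^ n i` are smaller than `B`,
a linear functional of them can be computed from the digits of the value at `X = B`. -/
theorem sum_mul_comp_eq_sum_digits {ι : Type*} (S : Finset ι) (c n : ι → ℕ) (f : ℕ → ℕ) {B M : ℕ}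
    (hn : ∀ i ∈ S, n i < M) (hc : ∑ i ∈ S, c i < B) :
    ∑ i ∈ S, c i * f (n i) =
      ∑ m ∈ range M, (∑ i ∈ S, c i * B ^ n i) / B ^ m % B * f m := by
  have key (h : ℕ → ℕ) : ∑ i ∈ S, c i * h (n i) =
      ∑ m ∈ range M, (∑ i ∈ S with n i = m, c i) * h m := by
    rw [← sum_fiberwise_of_maps_to (t := range M) (g := n) (by simpa using hn)]
    refine sum_congr rfl fun m _ => ?_
    rw [sum_mul]
    refine sum_congr rfl fun i hi => ?_
    rw [(mem_filter.mp hi).2]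
  rw [key f]
  refine sum_congr rfl fun m hm => ?_
  rw [key, sum_mul_pow_div_pow_mod _ _ M m (mem_range.mp hm)]
  exact fun m => (sum_le_sum_of_subset (filter_subset _ _)).trans_lt hc

theorem sum_piFinset_fin_four {M : Type*} [AddCommMonoid M] (s : Fin 4 → Finset ℕ)
    (f : (Fin 4 → ℕ) → M) :
    ∑ k ∈ Fintype.piFinset s, f k =
      ∑ a ∈ s 0, ∑ b ∈ s 1, ∑ c ∈ s 2, ∑ d ∈ s 3, f ![a, b, c, d] := by
  simp only [← sum_product']
  refine sum_nbij' (fun k => (k 0, k 1, k 2, k 3))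
    (fun q => ![q.1, q.2.1, q.2.2.1, q.2.2.2]) ?_ ?_ ?_ ?_ ?_
  · simp +contextual
  · simp [Fin.forall_fin_succ]
  · intro k _; ext i; fin_cases i <;> rfl
  · simp
  · intro k _; congr 1; ext i; fin_cases i <;> rfl

theorem sum_range_mul_eq_sum_sum {M : Type*} [AddCommMonoid M] (a b : ℕ) (f : ℕ → M) :
    ∑ m ∈ range (a * b), f m = ∑ i ∈ range a, ∑ j ∈ range b, f (i * b + j) := by
  induction a with
  | zero => simp
  | succ a ih => rw [Nat.succ_mul, sum_range_add, ih, sum_range_succ]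

end Finset


/-- The beta integral with natural exponents. -/
theorem integral_pow_mul_sub_pow (c : ℝ) (a b : ℕ) :
    ∫ x in (0 : ℝ)..c, x ^ a * (c - x) ^ b =
      c ^ (a + b + 1) * (a.factorial * b.factorial / (a + b + 1).factorial) := by
  induction b generalizing a with
  | zero =>
    rw [add_zero, Nat.factorial_succ]
    have := a.factorial_ne_zero
    simp [integral_pow]
    field_simp
  | succ b ih =>
    have hu (x : ℝ) : HasDerivAt (fun x : ℝ => (c - x) ^ (b + 1)) (-((b + 1) * (c - x) ^ b)) x := by
      simpa using ((hasDerivAt_id x).const_sub c).fun_pow (b + 1)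
    have hv (x : ℝ) : HasDerivAt (fun x : ℝ => x ^ (a + 1) / (a + 1)) (x ^ a) x := by
      have := (hasDerivAt_pow (a + 1) x).div_const ((a : ℝ) + 1)
      rwa [Nat.cast_succ, Nat.add_sub_cancel, mul_div_cancel_left₀ _ (by positivity)] at this
    have h := intervalIntegral.integral_mul_deriv_eq_deriv_mul (a := 0) (b := c)
      (fun x _ => hu x) (fun x _ => hv x)
      (by apply Continuous.intervalIntegrable; fun_prop)
      (by apply Continuous.intervalIntegrable; fun_prop)
    have e (x : ℝ) : -((b + 1) * (c - x) ^ b) * (x ^ (a + 1) / (a + 1)) =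
        -((b + 1) / (a + 1)) * (x ^ (a + 1) * (c - x) ^ b) := by ring
    simp only [mul_comm (_ ^ a)]
    rw [h]
    simp only [e, intervalIntegral.integral_const_mul, ih]
    rw [show a + 1 + b + 1 = a + (b + 1) + 1 by ring, Nat.factorial_succ a, Nat.factorial_succ b]
    push_cast
    field_simp
    simp

/-- The solid simplex of nonnegative vectors in `ℝ^t` with coordinate sum at most `c`. -/
def cornerSimplex (t : ℕ) (c : ℝ) : Set (Fin t → ℝ) :=
  {θ | (∀ i, 0 ≤ θ i) ∧ ∑ i, θ i ≤ c}

theorem isCompact_cornerSimplex (t : ℕ) (c : ℝ) : IsCompact (cornerSimplex t c) := by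
  refine (isCompact_Icc (a := 0) (b := fun _ => c)).of_isClosed_subset ?_ fun θ hθ =>
    ⟨hθ.1, fun i => (Finset.single_le_sum (fun j _ => hθ.1 j) (Finset.mem_univ i)).trans hθ.2⟩
  simp only [cornerSimplex, Set.ofPred_and, Set.ofPred_forall]
  exact (isClosed_iInter fun i => isClosed_le (by fun_prop) (by fun_prop)).inter
    (isClosed_le (by fun_prop) (by fun_prop))

/-- **Dirichlet's integral** over a solid simplex. -/
theorem setIntegral_cornerSimplex (t : ℕ) (c : ℝ) (hc : 0 ≤ c) (n : Fin t → ℕ) (m : ℕ) :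
    ∫ θ in cornerSimplex t c, (∏ i, θ i ^ n i) * (c - ∑ i, θ i) ^ m =
      c ^ (∑ i, n i + m + t) *
        ((∏ i, ((n i).factorial : ℝ)) * m.factorial / (∑ i, n i + m + t).factorial) := by
  induction t generalizing c with
  | zero =>
    have : cornerSimplex 0 c = Set.univ := by
      ext θ; simp [cornerSimplex, hc]
    have := m.factorial_ne_zero
    simp [*, Measure.real, Measure.volume_pi_eq_dirac 0]
  | succ t ih =>
    set F : (Fin (t + 1) → ℝ) → ℝ := fun θ => (∏ i, θ i ^ n i) * (c - ∑ i, θ i) ^ m with hF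
    have hS := (isCompact_cornerSimplex (t + 1) c).measurableSet
    have hint : Integrable ((cornerSimplex (t + 1) c).indicator F) := by
      rw [integrable_indicator_iff hS]
      exact (by fun_prop : Continuous F).continuousOn.integrableOn_compact
        (isCompact_cornerSimplex _ _)
    have mp := (volume_preserving_piFinSuccAbove (fun _ : Fin (t + 1) => ℝ) 0).symm
    change ∫ θ in cornerSimplex (t + 1) c, F θ = _
    rw [← integral_indicator hS, ← mp.integral_comp', Measure.volume_eq_prod,
      integral_prod (fun z => (cornerSimplex (t + 1) c).indicator F
        ((MeasurableEquiv.piFinSuccAbove (fun _ : Fin (t + 1) => ℝ) 0).symm z))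
        (mp.integrable_comp_of_integrable hint)]
    have key (x : ℝ) : ∫ y : Fin t → ℝ, (cornerSimplex (t + 1) c).indicator F
          ((MeasurableEquiv.piFinSuccAbove (fun _ : Fin (t + 1) => ℝ) 0).symm (x, y)) =
        (Set.Icc 0 c).indicator (fun x =>
          ((∏ i : Fin t, ((n i.succ).factorial : ℝ)) * m.factorial /
              (∑ i : Fin t, n i.succ + m + t).factorial) *
            (x ^ n 0 * (c - x) ^ (∑ i : Fin t, n i.succ + m + t))) x := by
      have mem (y : Fin t → ℝ) : Fin.cons (α := fun _ => ℝ) x y ∈ cornerSimplex (t + 1) c ↔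
          0 ≤ x ∧ y ∈ cornerSimplex t (c - x) := by
        simp [cornerSimplex, Fin.forall_fin_succ, Fin.sum_univ_succ, le_sub_iff_add_le', and_assoc]
      have hcons (y : Fin t → ℝ) : (MeasurableEquiv.piFinSuccAbove (fun _ : Fin (t + 1) => ℝ) 0).symm
          (x, y) = Fin.cons (α := fun _ => ℝ) x y := Fin.insertNth_zero' x y
      simp only [hcons]
      by_cases hx : x ∈ Set.Icc 0 c
      · rw [Set.indicator_of_mem hx, mul_left_comm, mul_comm _ ((c - x) ^ _),
          ← ih (c - x) (sub_nonneg.2 hx.2), ← integral_const_mul,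
          ← integral_indicator (isCompact_cornerSimplex _ _).measurableSet]
        congr 1 with y
        by_cases hy : y ∈ cornerSimplex t (c - x)
        · rw [Set.indicator_of_mem ((mem y).2 ⟨hx.1, hy⟩), Set.indicator_of_mem hy]
          simp [hF, Fin.prod_univ_succ, Fin.sum_univ_succ, mul_assoc, sub_sub]
        · rw [Set.indicator_of_notMem (fun h => hy ((mem y).1 h).2), Set.indicator_of_notMem hy]
      · rw [Set.indicator_of_notMem hx]
        refine integral_eq_zero_of_ae (.of_forall fun y => Set.indicator_of_notMem (fun h => hx ?_) _)
        obtain ⟨h0, h1, h2⟩ := (mem y).1 h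
        exact ⟨h0, sub_nonneg.1 ((Finset.sum_nonneg fun i _ => h1 i).trans h2)⟩
    simp_rw [key]
    rw [integral_indicator measurableSet_Icc, integral_const_mul, integral_Icc_eq_integral_Ioc,
      ← intervalIntegral.integral_of_le hc, integral_pow_mul_sub_pow]
    simp only [Fin.sum_univ_succ, Fin.prod_univ_succ]
    rw [show n 0 + (∑ i : Fin t, n i.succ + m + t) + 1 =
      n 0 + ∑ i : Fin t, n i.succ + m + (t + 1) by ring]
    field_simp

instance (t : ℕ) : SFinite (simplexMeasure t) := by
  unfold simplexMeasure
  infer_instance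

/-- The moments of the uniform distribution on the standard simplex. -/
theorem integral_simplexMeasure (t : ℕ) (n : Fin (t + 1) → ℕ) :
    ∫ x, ∏ i, x i ^ n i ∂simplexMeasure t =
      t.factorial * (∏ i, ((n i).factorial : ℝ)) / (∑ i, n i + t).factorial := by
  have hm : Measurable fun θ : Fin t → ℝ => (Fin.cons (1 - ∑ i, θ i) θ : Fin (t + 1) → ℝ) := by
    refine measurable_pi_iff.2 (Fin.cases ?_ fun i => ?_) <;>
      simp only [Fin.cons_zero, Fin.cons_succ] <;> fun_prop
  rw [simplexMeasure, integral_map hm.aemeasurable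
    (by fun_prop : Continuous fun x : Fin (t + 1) → ℝ => ∏ i, x i ^ n i).aestronglyMeasurable,
    integral_smul_measure]
  have h := setIntegral_cornerSimplex t 1 zero_le_one (fun i => n i.succ) (n 0)
  simp only [Fin.prod_univ_succ, Fin.sum_univ_succ, Fin.cons_zero, Fin.cons_succ]
  simp only [mul_comm _ (_ ^ n 0), cornerSimplex] at h
  rw [h]
  simp only [ENNReal.toReal_natCast, one_pow, one_mul, smul_eq_mul]
  rw [add_comm (n 0)]
  field_simp

theorem integral_simplexMeasure_one (a b : ℕ) :
    ∫ x : Fin 2 → ℝ, ∏ i, x i ^ ![a, b] i ∂simplexMeasure 1 =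
      a.factorial * b.factorial / (a + b + 1).factorial := by
  refine (integral_simplexMeasure 1 ![a, b]).trans ?_
  simp [Fin.prod_univ_succ, Fin.sum_univ_succ]

/-- The integral over `Δ_1 × Δ_3 × Δ_3 × Δ_3 × Δ_3` of the monomial with exponent tables `K`, `L`. -/
theorem integral_monomial (K L : Fin 4 → Fin 4 → ℕ) :
    ∫ p : (Fin 2 → ℝ) × ((Fin 4 → ℝ) × ((Fin 4 → ℝ) × ((Fin 4 → ℝ) × (Fin 4 → ℝ)))),
        ∏ i, ∏ j, ((p.1 0 * p.2.1 i * p.2.2.1 j) ^ K i j *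
          (p.1 1 * p.2.2.2.1 i * p.2.2.2.2 j) ^ L i j)
        ∂((simplexMeasure 1).prod ((simplexMeasure 3).prod
          ((simplexMeasure 3).prod ((simplexMeasure 3).prod (simplexMeasure 3))))) =
      ((∑ i, ∑ j, K i j).factorial * (∑ i, ∑ j, L i j).factorial /
          (∑ i, ∑ j, K i j + ∑ i, ∑ j, L i j + 1).factorial) *
        ((6 * (∏ i, ((∑ j, K i j).factorial : ℝ)) / (∑ i, ∑ j, K i j + 3).factorial) *
        ((6 * (∏ j, ((∑ i, K i j).factorial : ℝ)) / (∑ i, ∑ j, K i j + 3).factorial) *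
        ((6 * (∏ i, ((∑ j, L i j).factorial : ℝ)) / (∑ i, ∑ j, L i j + 3).factorial) *
        (6 * (∏ j, ((∑ i, L i j).factorial : ℝ)) / (∑ i, ∑ j, L i j + 3).factorial)))) := by
  have col (x : Fin 4 → ℝ) (M : Fin 4 → Fin 4 → ℕ) :
      ∏ i, ∏ j, x j ^ M i j = ∏ j, x j ^ ∑ i, M i j := by
    rw [Finset.prod_comm]
    simp only [Finset.prod_pow_eq_pow_sum]
  have split (p : (Fin 2 → ℝ) × ((Fin 4 → ℝ) × ((Fin 4 → ℝ) × ((Fin 4 → ℝ) × (Fin 4 → ℝ))))) :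
      ∏ i, ∏ j, ((p.1 0 * p.2.1 i * p.2.2.1 j) ^ K i j *
          (p.1 1 * p.2.2.2.1 i * p.2.2.2.2 j) ^ L i j) =
        (∏ a, p.1 a ^ (![∑ i, ∑ j, K i j, ∑ i, ∑ j, L i j] a)) *
          ((∏ i, p.2.1 i ^ ∑ j, K i j) * ((∏ j, p.2.2.1 j ^ ∑ i, K i j) *
            ((∏ i, p.2.2.2.1 i ^ ∑ j, L i j) * ∏ j, p.2.2.2.2 j ^ ∑ i, L i j))) := by
    simp only [mul_pow, Finset.prod_mul_distrib, col, Finset.prod_pow_eq_pow_sum]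
    simp only [Fin.prod_univ_two, Matrix.cons_val_zero, Matrix.cons_val_one]
    ring
  simp only [split]
  rw [integral_prod_mul (fun x : Fin 2 → ℝ => ∏ a, x a ^ (![∑ i, ∑ j, K i j, ∑ i, ∑ j, L i j] a))
      (fun p : (Fin 4 → ℝ) × ((Fin 4 → ℝ) × ((Fin 4 → ℝ) × (Fin 4 → ℝ))) =>
        (∏ i, p.1 i ^ ∑ j, K i j) * ((∏ j, p.2.1 j ^ ∑ i, K i j) *
            ((∏ i, p.2.2.1 i ^ ∑ j, L i j) * ∏ j, p.2.2.2 j ^ ∑ i, L i j))),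
    integral_prod_mul (fun x : Fin 4 → ℝ => ∏ i, x i ^ ∑ j, K i j)
      (fun p : (Fin 4 → ℝ) × ((Fin 4 → ℝ) × (Fin 4 → ℝ)) =>
        (∏ j, p.1 j ^ ∑ i, K i j) *
            ((∏ i, p.2.1 i ^ ∑ j, L i j) * ∏ j, p.2.2 j ^ ∑ i, L i j)),
    integral_prod_mul (fun x : Fin 4 → ℝ => ∏ j, x j ^ ∑ i, K i j)
      (fun p : (Fin 4 → ℝ) × (Fin 4 → ℝ) =>
        (∏ i, p.1 i ^ ∑ j, L i j) * ∏ j, p.2 j ^ ∑ i, L i j),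
    integral_prod_mul (fun x : Fin 4 → ℝ => ∏ i, x i ^ ∑ j, L i j)
      (fun x : Fin 4 → ℝ => ∏ j, x j ^ ∑ i, L i j)]
  rw [integral_simplexMeasure_one]
  simp only [integral_simplexMeasure]
  rw [Finset.sum_comm (f := fun j i => K i j), Finset.sum_comm (f := fun j i => L i j)]
  simp only [show (3).factorial = 6 from rfl, Nat.cast_ofNat]

theorem integrable_monomial (K L : Fin 4 → Fin 4 → ℕ) :
    Integrable (fun p : (Fin 2 → ℝ) ×
        ((Fin 4 → ℝ) × ((Fin 4 → ℝ) × ((Fin 4 → ℝ) × (Fin 4 → ℝ)))) =>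
        ∏ i, ∏ j, ((p.1 0 * p.2.1 i * p.2.2.1 j) ^ K i j *
          (p.1 1 * p.2.2.2.1 i * p.2.2.2.2 j) ^ L i j))
        ((simplexMeasure 1).prod ((simplexMeasure 3).prod
          ((simplexMeasure 3).prod ((simplexMeasure 3).prod (simplexMeasure 3))))) :=
  .of_integral_ne_zero (by rw [integral_monomial]; positivity)

/-- The factor contributed to the integral of a monomial by the exponent `r` of one of the
coordinates of `λ`, the complementary exponent of `ρ` being `10 - r`. -/
def marginWeight (r : ℕ) : ℕ := r.factorial * (10 - r).factorial

/-- The factor contributed to the integral of a monomial by the exponent `p` of `π`, after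
clearing the common denominator `41! * 46! ^ 2`. -/
def totalWeight (p : ℕ) : ℕ := p.factorial * (40 - p).factorial * (46).choose (p + 3) ^ 2

theorem integral_eq_sum (U : Fin 4 → Fin 4 → ℕ) (hrow : ∀ i, ∑ j, U i j = 10)
    (hcol : ∀ j, ∑ i, U i j = 10) :
    (∫ p : (Fin 2 → ℝ) ×
        ((Fin 4 → ℝ) × ((Fin 4 → ℝ) × ((Fin 4 → ℝ) × (Fin 4 → ℝ)))),
        ∏ i : Fin 4, ∏ j : Fin 4,
          (p.1 0 * p.2.1 i * p.2.2.1 j + p.1 1 * p.2.2.2.1 i * p.2.2.2.2 j) ^ U i j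
        ∂((simplexMeasure 1).prod
            ((simplexMeasure 3).prod
              ((simplexMeasure 3).prod
                ((simplexMeasure 3).prod (simplexMeasure 3)))))) =
      1296 / ((41).factorial * (46).factorial ^ 2) *
        (∑ K ∈ Fintype.piFinset fun i => Fintype.piFinset fun j => Finset.range (U i j + 1),
          (∏ i, ((∏ j, (U i j).choose (K i j)) * marginWeight (∑ j, K i j))) *
            ((∏ j, marginWeight (∑ i, K i j)) * totalWeight (∑ i, ∑ j, K i j)) : ℕ) := by
  simp only [add_pow, Finset.prod_univ_sum]
  simp only [Finset.prod_mul_distrib (g := fun j => ((U _ j).choose _ : ℝ)),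
    Finset.prod_mul_distrib (g := fun i => ∏ j, ((U i j).choose _ : ℝ))]
  rw [integral_finsetSum _ fun K _ => (integrable_monomial K fun i j => U i j - K i j).mul_const _,
    Nat.cast_sum, Finset.mul_sum]
  refine Finset.sum_congr rfl fun K hK => ?_
  have hle (i j) : K i j ≤ U i j := by
    simp only [Fintype.mem_piFinset, Finset.mem_range] at hK
    exact Nat.lt_succ_iff.1 (hK i j)
  have hr (i) : ∑ j, (U i j - K i j) = 10 - ∑ j, K i j := by
    rw [← hrow i, Finset.sum_tsub_distrib _ fun j _ => hle i j]
  have hs (j) : ∑ i, (U i j - K i j) = 10 - ∑ i, K i j := by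
    rw [← hcol j, Finset.sum_tsub_distrib _ fun i _ => hle i j]
  have hr' (i) : ∑ j, K i j ≤ 10 := hrow i ▸ Finset.sum_le_sum fun j _ => hle i j
  have hp : ∑ i, (10 - ∑ j, K i j) = 40 - ∑ i, ∑ j, K i j := by
    rw [Finset.sum_tsub_distrib _ fun i _ => hr' i]
    simp
  have hp' : ∑ i, ∑ j, K i j ≤ 40 := (Finset.sum_le_sum fun i _ => hr' i).trans (by simp)
  rw [integral_mul_const, integral_monomial]
  simp only [hr, hs, hp, marginWeight, totalWeight]
  generalize ∑ i, ∑ j, K i j = p at *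
  rw [Nat.add_sub_cancel' hp']
  push_cast [Finset.prod_mul_distrib]
  rw [Nat.cast_choose ℝ (by omega : p + 3 ≤ 46), show 46 - (p + 3) = 40 - p + 3 by omega]
  have h46 := (46).factorial_pos
  have h41 := (41).factorial_pos
  generalize (46).factorial = A at *
  generalize (41).factorial = B at *
  field_simp
  ring

/-- The number with base `11` digits `k`. -/
def columnIndex (k : Fin 4 → ℕ) : ℕ := k 0 + 11 * k 1 + 121 * k 2 + 1331 * k 3

/-- The product of the margin weights and the total weight of the four base `11` digits of `m`. -/
def indexWeight (m : ℕ) : ℕ :=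
  marginWeight (m % 121 % 11) * marginWeight (m % 121 / 11) * marginWeight (m / 121 % 11) *
    marginWeight (m / 121 / 11) *
    totalWeight (m % 121 % 11 + m % 121 / 11 + m / 121 % 11 + m / 121 / 11)

theorem indexWeight_columnIndex (s : Fin 4 → ℕ) (hs : ∀ j, s j ≤ 10) :
    indexWeight (columnIndex s) = (∏ j, marginWeight (s j)) * totalWeight (∑ j, s j) := by
  have h0 := hs 0
  have h1 := hs 1
  have h2 := hs 2
  have h3 := hs 3
  have e0 : columnIndex s % 121 % 11 = s 0 := by unfold columnIndex; omega
  have e1 : columnIndex s % 121 / 11 = s 1 := by unfold columnIndex; omega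
  have e2 : columnIndex s / 121 % 11 = s 2 := by unfold columnIndex; omega
  have e3 : columnIndex s / 121 / 11 = s 3 := by unfold columnIndex; omega
  simp only [indexWeight, e0, e1, e2, e3, Fin.prod_univ_four, Fin.sum_univ_four]

/-- `∑ i < n, f i`, in a form that the kernel evaluates quickly. -/
def sumBelow (n : ℕ) (f : ℕ → ℕ) : ℕ := Nat.rec 0 (fun i s => Nat.add s (f i)) n

theorem sumBelow_eq (n : ℕ) (f : ℕ → ℕ) : sumBelow n f = ∑ i ∈ Finset.range n, f i := by
  induction n with
  | zero => rfl
  | succ n ih => rw [Finset.sum_range_succ, ← ih]; rfl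

/-- `f n`, in a form that makes the kernel evaluate `n` only once. -/
def withValue (n : ℕ) (f : ℕ → ℕ) : ℕ := Nat.rec (f 0) (fun k _ => f (Nat.succ k)) n

theorem withValue_eq (n : ℕ) (f : ℕ → ℕ) : withValue n f = f n := by cases n <;> rfl

/-- The digit of index `m` of `N` in base `2 ^ b`. -/
def binaryDigit (b N m : ℕ) : ℕ := Nat.mod (Nat.shiftRight N (Nat.mul b m)) (Nat.pow 2 b)

theorem binaryDigit_eq (b N m : ℕ) : binaryDigit b N m = N / (2 ^ b) ^ m % 2 ^ b := by
  rw [← pow_mul, ← Nat.shiftRight_eq_div_pow]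
  rfl

theorem binaryDigit_binaryDigit {k l : ℕ} (hl : l < k) (b N h : ℕ) :
    binaryDigit b (binaryDigit (b * k) N h) l = binaryDigit b N (h * k + l) := by
  obtain ⟨d, rfl⟩ : ∃ d, k = l + (d + 1) := ⟨k - l - 1, by omega⟩
  simp only [binaryDigit_eq]
  rw [pow_mul 2 b, pow_add _ l, Nat.mod_mul_right_div_self,
    Nat.mod_mod_of_dvd _ (dvd_pow_self _ d.succ_ne_zero),
    Nat.div_div_eq_div_mul, ← pow_add, ← pow_mul, ← pow_add, mul_comm h]

/-- The value at `Y` of the weighted generating polynomial of the vectors `k ≤ u`, where `k` is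
recorded in the exponent `columnIndex k`. -/
def rowEval (Y u₀ u₁ u₂ u₃ : ℕ) : ℕ :=
  sumBelow (u₀ + 1) fun a => sumBelow (u₁ + 1) fun b =>
    sumBelow (u₂ + 1) fun c => sumBelow (u₃ + 1) fun d =>
      u₀.choose a * u₁.choose b * u₂.choose c * u₃.choose d * marginWeight (a + b + c + d) *
        Y ^ (a + 11 * b + 121 * c + 1331 * d)

theorem rowEval_eq (Y : ℕ) (u : Fin 4 → ℕ) :
    rowEval Y (u 0) (u 1) (u 2) (u 3) =
      ∑ k ∈ Fintype.piFinset fun j => Finset.range (u j + 1),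
        (∏ j, (u j).choose (k j)) * marginWeight (∑ j, k j) * Y ^ columnIndex k := by
  rw [Finset.sum_piFinset_fin_four]
  simp [rowEval, sumBelow_eq, columnIndex, Fin.prod_univ_four, Fin.sum_univ_four]

/-- The value at `Y` of the generating polynomial of the exponent tables bounded by the `4 × 4`
table with diagonal entries `4` and off-diagonal entries `2`, graded by column sums. -/
def tableEval (Y : ℕ) : ℕ :=
  rowEval Y 4 2 2 2 * rowEval Y 2 4 2 2 * rowEval Y 2 2 4 2 * rowEval Y 2 2 2 4

theorem columnIndex_sum (K : Fin 4 → Fin 4 → ℕ) :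
    columnIndex (fun j => ∑ i, K i j) = ∑ i, columnIndex (K i) := by
  simp only [columnIndex, Finset.sum_add_distrib, Finset.mul_sum]

theorem tableEval_eq (Y : ℕ) (U : Fin 4 → Fin 4 → ℕ) (hU : ∀ i j, U i j = if i = j then 4 else 2) :
    tableEval Y =
      ∑ K ∈ Fintype.piFinset fun i => Fintype.piFinset fun j => Finset.range (U i j + 1),
        (∏ i, ((∏ j, (U i j).choose (K i j)) * marginWeight (∑ j, K i j))) *
          Y ^ columnIndex fun j => ∑ i, K i j := by
  simp only [columnIndex_sum, ← Finset.prod_pow_eq_pow_sum, ← Finset.prod_mul_distrib]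
  rw [← Finset.prod_univ_sum (fun i => Fintype.piFinset fun j => Finset.range (U i j + 1))
    fun i k => (∏ j, (U i j).choose (k j)) * marginWeight (∑ j, k j) * Y ^ columnIndex k]
  rw [Finset.prod_congr rfl fun i _ => (rowEval_eq Y (U i)).symm]
  simp [tableEval, Fin.prod_univ_four, hU]

/-- The margin weights as the digits of a number in base `2 ^ 24`. -/
def packedMarginWeights : ℕ := sumBelow 11 fun r => marginWeight r * 2 ^ (24 * r)

/-- The total weights as the digits of a number in base `2 ^ 208`. -/
def packedTotalWeights : ℕ := sumBelow 41 fun p => totalWeight p * 2 ^ (208 * p)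

theorem binaryDigit_packedMarginWeights :
    ∀ r < 11, binaryDigit 24 packedMarginWeights r = marginWeight r := by decide +kernel

theorem binaryDigit_packedTotalWeights :
    ∀ p < 41, binaryDigit 208 packedTotalWeights p = totalWeight p := by decide +kernel

/-- The weighted sum over all coefficients of the generating polynomial, which are read off as the
digits of its value at `2 ^ 104`. -/
def weightedSum : ℕ :=
  withValue packedMarginWeights fun W => withValue packedTotalWeights fun V =>
  withValue (tableEval (2 ^ 104)) fun N =>
    sumBelow 121 fun h => withValue (binaryDigit (104 * 121) N h) fun B =>
      sumBelow 121 fun l =>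
        Nat.mul (binaryDigit 104 B l)
          (binaryDigit 24 W (l % 11) * binaryDigit 24 W (l / 11) * binaryDigit 24 W (h % 11) *
            binaryDigit 24 W (h / 11) * binaryDigit 208 V (l % 11 + l / 11 + h % 11 + h / 11))

theorem weightedSum_eq :
    weightedSum = ∑ m ∈ Finset.range (121 * 121),
      tableEval (2 ^ 104) / (2 ^ 104) ^ m % 2 ^ 104 * indexWeight m := by
  simp only [weightedSum, withValue_eq, sumBelow_eq, Finset.sum_range_mul_eq_sum_sum]
  refine Finset.sum_congr rfl fun h hh => Finset.sum_congr rfl fun l hl => ?_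
  rw [Finset.mem_range] at hh hl
  rw [binaryDigit_binaryDigit hl, binaryDigit_packedMarginWeights _ (by omega),
    binaryDigit_packedMarginWeights _ (by omega), binaryDigit_packedMarginWeights _ (by omega),
    binaryDigit_packedMarginWeights _ (by omega), binaryDigit_packedTotalWeights _ (by omega),
    binaryDigit_eq, indexWeight, show (h * 121 + l) % 121 = l by omega,
    show (h * 121 + l) / 121 = h by omega]
  rfl

theorem weightedSum_eq_value :
    weightedSum =
      739262738168348883422984688555628978010679607349855029385028546285261296527433939235356698214400000000000000000 := by
  decide +kernel

theorem tableEval_one_lt : tableEval 1 < 2 ^ 104 := by decide +kernel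

/-- The 100 Swiss Francs integral: for the 4×4 table `U` with diagonal entries 4 and
off-diagonal entries 2,
`∫_Θ ∏_{i,j} (π λ^{(1)}_i λ^{(2)}_j + τ ρ^{(1)}_i ρ^{(2)}_j)^{U_{ij}} dπ dτ dλ dρ`
over `Θ = Δ_1 × Δ_3 × Δ_3 × Δ_3 × Δ_3` with the product Lebesgue probability measure
equals the stated rational number. -/
theorem swiss_francs_integral
    (U : Fin 4 → Fin 4 → ℕ) (hU : ∀ i j, U i j = if i = j then 4 else 2) :
    (∫ p : (Fin 2 → ℝ) ×
        ((Fin 4 → ℝ) × ((Fin 4 → ℝ) × ((Fin 4 → ℝ) × (Fin 4 → ℝ)))),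
        ∏ i : Fin 4, ∏ j : Fin 4,
          (p.1 0 * p.2.1 i * p.2.2.1 j + p.1 1 * p.2.2.2.1 i * p.2.2.2.2 j) ^ U i j
        ∂((simplexMeasure 1).prod
            ((simplexMeasure 3).prod
              ((simplexMeasure 3).prod
                ((simplexMeasure 3).prod (simplexMeasure 3))))))
      = ((571 * 773426813 * 17682039596993 * 625015426432626533 : ℝ) /
          (2 ^ 31 * 3 ^ 20 * 5 ^ 12 * 7 ^ 11 * 11 ^ 8 * 13 ^ 7 * 17 ^ 5 * 19 ^ 5 *
            23 ^ 5 * 29 ^ 3 * 31 ^ 3 * 37 ^ 3 * 41 ^ 3 * 43 ^ 2)) := by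
  have hrow (i) : ∑ j, U i j = 10 := by
    simp only [hU]; revert i; decide
  have hcol (j) : ∑ i, U i j = 10 := by
    simp only [hU]; revert j; decide
  have hs {K : Fin 4 → Fin 4 → ℕ}
      (hK : K ∈ Fintype.piFinset fun i => Fintype.piFinset fun j => Finset.range (U i j + 1)) (j) :
      ∑ i, K i j ≤ 10 := by
    simp only [Fintype.mem_piFinset, Finset.mem_range, Nat.lt_succ_iff] at hK
    exact hcol j ▸ Finset.sum_le_sum fun i _ => hK i j
  have hsum : ∑ K ∈ Fintype.piFinset fun i => Fintype.piFinset fun j => Finset.range (U i j + 1),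
      (∏ i, ((∏ j, (U i j).choose (K i j)) * marginWeight (∑ j, K i j))) *
        ((∏ j, marginWeight (∑ i, K i j)) * totalWeight (∑ i, ∑ j, K i j)) = weightedSum := by
    rw [weightedSum_eq, tableEval_eq _ U hU, ← Finset.sum_mul_comp_eq_sum_digits]
    · refine Finset.sum_congr rfl fun K hK => ?_
      rw [indexWeight_columnIndex _ (hs hK), Finset.sum_comm]
    · intro K hK
      have h0 := hs hK 0
      have h1 := hs hK 1
      have h2 := hs hK 2
      have h3 := hs hK 3
      simp only [columnIndex]
      omega
    · simpa [tableEval_eq 1 U hU] using tableEval_one_lt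
  rw [integral_eq_sum U hrow hcol, hsum, weightedSum_eq_value]
  norm_num [Nat.factorial]
end
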